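/- In the boundary case of Theorem 1 (I = {i : αᵢ + σ₀ = 0} ≠ ∅, ψᵢ + σ₀φᵢ = 0 for all i ∈ I, and sup_{σ∈(σ₀,∞)} Πᵈ(σ) = lim_{σ→σ₀⁺} Πᵈ(σ) > −∞), write w_j* = (ψ_j + σ₀φ_j)/(α_j + σ₀) for j ∈ J = {1,…,n}\I and let R² = Σ_{i∈I} φᵢ² − Σ_{j∈J} ((w_j*)² − 2φ_jw_j*) + 2σ₀ + 2ν. If R² > 0 (equivalently, lim_{σ→σ₀⁺} (Πᵈ)′(σ) < 0), then the set of global minimizers of (P) is exactly the set of (σ₀, w*) with w_j* as above for j ∈ J and with the coordinates (wᵢ*)_{i∈I} ranging over the sphere Σ_{i∈I} (wᵢ* − φᵢ)² = R² centered at (φᵢ)_{i∈I} of positive radius √(R²); if R² = 0, then (P) has the unique global minimizer given by ξ* = σ₀, w_j* as above for j ∈ J, and wᵢ* = φᵢ for every i ∈ I. -/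

import Mathlib

open scoped BigOperators Classical

/-- Completing the square at `σ` in the primal objective along the constraint. -/
theorem primal_eq_add_squares {ι : Type*} [Fintype ι] (α ψ φ w : ι → ℝ) (ν σ ξ : ℝ)
    (hψ : ∀ i, α i + σ = 0 → ψ i + σ * φ i = 0)
    (hξ : ξ = ∑ i, ((1/2) * (w i)^2 - φ i * w i) - ν) :
    (1/2) * ξ^2 + ∑ i, ((1/2) * α i * (w i)^2 - ψ i * w i) =
      (-(1/2) * σ^2 - (1/2) * ∑ i, (ψ i + σ * φ i)^2 / (α i + σ) - ν * σ)
        + ((1/2) * (ξ - σ)^2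
          + ∑ i, (1/2) * (α i + σ) * (w i - (ψ i + σ * φ i) / (α i + σ))^2) := by
  have key : ∀ i, (1/2) * α i * (w i)^2 - ψ i * w i =
      (1/2) * (α i + σ) * (w i - (ψ i + σ * φ i) / (α i + σ))^2
        - (1/2) * ((ψ i + σ * φ i)^2 / (α i + σ)) - σ * ((1/2) * (w i)^2 - φ i * w i) := by
    intro i
    by_cases h : α i + σ = 0
    · have h1 := hψ i h
      have h2 : α i = -σ := by linarith
      have h3 : ψ i = -(σ * φ i) := by linarith
      rw [h1, h, h2, h3]
      ring
    · field_simp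
      ring
  rw [Finset.sum_congr rfl fun i _ => key i, Finset.sum_sub_distrib, Finset.sum_sub_distrib,
    ← Finset.mul_sum, ← Finset.mul_sum]
  have hs : ∑ i, ((1/2) * (w i)^2 - φ i * w i) = ξ + ν := by linarith
  rw [hs]
  ring

/-- The constraint function at a point whose coordinates violating `P` are prescribed, in terms of
the squared distance to `φ` on the coordinates satisfying `P`. -/
theorem constraint_eq_of_eq_off {ι : Type*} [Fintype ι] (P : ι → Prop) (φ v w : ι → ℝ)
    (hw : ∀ j, ¬ P j → w j = v j) :
    ∑ i, ((1/2) * (w i)^2 - φ i * w i) =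
      (1/2) * (∑ i ∈ Finset.univ.filter (fun i => P i), (w i - φ i)^2
        - (∑ i ∈ Finset.univ.filter (fun i => P i), (φ i)^2
          - ∑ j ∈ Finset.univ.filter (fun j => ¬ P j), ((v j)^2 - 2 * φ j * v j))) := by
  rw [← Finset.sum_filter_add_sum_filter_not Finset.univ (fun i => P i),
    ← sub_add, ← Finset.sum_sub_distrib, mul_add, Finset.mul_sum, Finset.mul_sum]
  congr 1
  · exact Finset.sum_congr rfl fun i _ => by ring
  · refine Finset.sum_congr rfl fun i hi => ?_
    rw [hw i (Finset.mem_filter.1 hi).2]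
    ring

/-- A sphere of squared radius `r ≥ 0` in nonempty coordinates contains a point with prescribed
remaining coordinates. -/
theorem exists_sphere_point {ι : Type*} [Fintype ι] (P : ι → Prop) (hP : ∃ i, P i)
    (φ v : ι → ℝ) {r : ℝ} (hr : 0 ≤ r) :
    ∃ w : ι → ℝ, (∀ j, ¬ P j → w j = v j) ∧
      ∑ i ∈ Finset.univ.filter (fun i => P i), (w i - φ i)^2 = r := by
  obtain ⟨k, hk⟩ := hP
  refine ⟨fun i => if P i then (if i = k then φ i + √r else φ i) else v i,
    fun j hj => if_neg hj, ?_⟩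
  rw [Finset.sum_eq_single_of_mem k (by simp [hk])]
  · simp [hk, Real.sq_sqrt hr]
  · intro i hi hik
    simp [(Finset.mem_filter.1 hi).2, hik]

/-- In the boundary case of Theorem 1, with
`w_j* = (ψ_j + σ₀φ_j)/(α_j + σ₀)` for `j ∈ J` and
`R² = Σ_{i∈I} φᵢ² − Σ_{j∈J} ((w_j*)² − 2φ_jw_j*) + 2σ₀ + 2ν`:
if `R² > 0` the global minimizers of (P) are exactly the pairs `(σ₀, w*)` with
`w_j* ` as above on `J` and `(wᵢ*)_{i∈I}` on the sphere `Σ_{i∈I}(wᵢ* − φᵢ)² = R²`;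
if `R² = 0` the unique global minimizer is `ξ* = σ₀`, `w_j*` as above on `J` and
`wᵢ* = φᵢ` on `I`. -/
theorem boundary_case_minimizer_sphere_or_unique
    (n : ℕ) (α ψ φ : Fin n → ℝ) (ν σ₀ : ℝ)
    (hσ₀ : IsGreatest (Set.range fun i => -α i) σ₀)
    (Pd : ℝ → ℝ)
    (hPd : ∀ σ, Pd σ = -(1/2) * σ^2 - (1/2) * ∑ i, (ψ i + σ * φ i)^2 / (α i + σ) - ν * σ)
    (Pp : ℝ → (Fin n → ℝ) → ℝ)
    (hPp : ∀ ξ w, Pp ξ w = (1/2) * ξ^2 + ∑ i, ((1/2) * α i * (w i)^2 - ψ i * w i))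
    (hI : ∃ i, α i + σ₀ = 0)
    (hψ : ∀ i, α i + σ₀ = 0 → ψ i + σ₀ * φ i = 0)
    (Lv : ℝ)
    (hlim : Filter.Tendsto Pd (nhdsWithin σ₀ (Set.Ioi σ₀)) (nhds Lv))
    (hsup : IsLUB (Pd '' Set.Ioi σ₀) Lv)
    (wJ : Fin n → ℝ)
    (hwJ : ∀ j, wJ j = (ψ j + σ₀ * φ j) / (α j + σ₀))
    (R2 : ℝ)
    (hR2 : R2 = ∑ i ∈ Finset.univ.filter (fun i => α i + σ₀ = 0), (φ i)^2
        - ∑ j ∈ Finset.univ.filter (fun j => α j + σ₀ ≠ 0), ((wJ j)^2 - 2 * φ j * wJ j)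
        + 2 * σ₀ + 2 * ν) :
    (R2 > 0 →
      {p : ℝ × (Fin n → ℝ) |
          p.1 = ∑ i, ((1/2) * (p.2 i)^2 - φ i * p.2 i) - ν ∧
          ∀ q : ℝ × (Fin n → ℝ), q.1 = ∑ i, ((1/2) * (q.2 i)^2 - φ i * q.2 i) - ν →
            Pp p.1 p.2 ≤ Pp q.1 q.2}
        = {p : ℝ × (Fin n → ℝ) |
            p.1 = σ₀ ∧
            (∀ j, α j + σ₀ ≠ 0 → p.2 j = wJ j) ∧
            ∑ i ∈ Finset.univ.filter (fun i => α i + σ₀ = 0), (p.2 i - φ i)^2 = R2}) ∧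
    (R2 = 0 →
      {p : ℝ × (Fin n → ℝ) |
          p.1 = ∑ i, ((1/2) * (p.2 i)^2 - φ i * p.2 i) - ν ∧
          ∀ q : ℝ × (Fin n → ℝ), q.1 = ∑ i, ((1/2) * (q.2 i)^2 - φ i * q.2 i) - ν →
            Pp p.1 p.2 ≤ Pp q.1 q.2}
        = {(σ₀, fun i => if α i + σ₀ = 0 then φ i else wJ i)}) := by
  have hα : ∀ i, 0 ≤ α i + σ₀ := fun i => by
    have := hσ₀.2 (Set.mem_range_self i)
    linarith
  have hval : ∀ q : ℝ × (Fin n → ℝ), q.1 = ∑ i, ((1/2) * (q.2 i)^2 - φ i * q.2 i) - ν →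
      Pp q.1 q.2 = Pd σ₀ + ((1/2) * (q.1 - σ₀)^2
        + ∑ i, (1/2) * (α i + σ₀) * (q.2 i - wJ i)^2) := fun q hq => by
    rw [hPp, hPd, primal_eq_add_squares α ψ φ q.2 ν σ₀ q.1 hψ hq]
    simp only [hwJ]
  have hnn : ∀ w : Fin n → ℝ, ∀ i ∈ Finset.univ,
      0 ≤ (1/2) * (α i + σ₀) * (w i - wJ i)^2 := fun w i _ =>
    mul_nonneg (mul_nonneg (by norm_num) (hα i)) (sq_nonneg _)
  have hfeas : ∀ w : Fin n → ℝ, (∀ j, α j + σ₀ ≠ 0 → w j = wJ j) →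
      ∑ i, ((1/2) * (w i)^2 - φ i * w i) - ν = σ₀ + (1/2) *
        (∑ i ∈ Finset.univ.filter (fun i => α i + σ₀ = 0), (w i - φ i)^2 - R2) := fun w hw => by
    have := constraint_eq_of_eq_off (fun i => α i + σ₀ = 0) φ wJ w hw
    simp only [← ne_eq] at this
    rw [this, hR2]
    ring
  have hopt : ∀ w : Fin n → ℝ, (∀ j, α j + σ₀ ≠ 0 → w j = wJ j) →
      ∑ i, (1/2) * (α i + σ₀) * (w i - wJ i)^2 = 0 := fun w hw =>
    Finset.sum_eq_zero fun i _ => by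
      by_cases h : α i + σ₀ = 0
      · simp [h]
      · simp [hw i h]
  have main : 0 ≤ R2 →
      {p : ℝ × (Fin n → ℝ) |
          p.1 = ∑ i, ((1/2) * (p.2 i)^2 - φ i * p.2 i) - ν ∧
          ∀ q : ℝ × (Fin n → ℝ), q.1 = ∑ i, ((1/2) * (q.2 i)^2 - φ i * q.2 i) - ν →
            Pp p.1 p.2 ≤ Pp q.1 q.2}
        = {p : ℝ × (Fin n → ℝ) |
            p.1 = σ₀ ∧
            (∀ j, α j + σ₀ ≠ 0 → p.2 j = wJ j) ∧
            ∑ i ∈ Finset.univ.filter (fun i => α i + σ₀ = 0), (p.2 i - φ i)^2 = R2} := by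
    intro hR
    ext p
    simp only [Set.mem_ofPred_eq]
    constructor
    · rintro ⟨hp, hmin⟩
      obtain ⟨w, hw, hws⟩ := exists_sphere_point (fun i => α i + σ₀ = 0) hI φ wJ hR
      have hwf : σ₀ = ∑ i, ((1/2) * (w i)^2 - φ i * w i) - ν := by
        rw [hfeas w hw, hws]
        ring
      have hle := hmin (σ₀, w) hwf
      rw [hval p hp, hval (σ₀, w) hwf, hopt w hw] at hle
      have hsum := Finset.sum_nonneg (hnn p.2)
      have hsq := sq_nonneg (p.1 - σ₀)
      have h1 : (p.1 - σ₀)^2 = 0 := by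
        simp only [sub_self] at hle
        linarith
      have h2 : ∑ i, (1/2) * (α i + σ₀) * (p.2 i - wJ i)^2 = 0 := by
        simp only [sub_self] at hle
        linarith
      have hp1 : p.1 = σ₀ := sub_eq_zero.1 (pow_eq_zero_iff two_ne_zero |>.1 h1)
      have hp2 : ∀ j, α j + σ₀ ≠ 0 → p.2 j = wJ j := fun j hj => by
        have := (Finset.sum_eq_zero_iff_of_nonneg (hnn p.2)).1 h2 j (Finset.mem_univ j)
        simpa [hj, sub_eq_zero] using this
      refine ⟨hp1, hp2, ?_⟩
      rw [hfeas p.2 hp2] at hp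
      linarith
    · rintro ⟨hp1, hp2, hps⟩
      have hp : p.1 = ∑ i, ((1/2) * (p.2 i)^2 - φ i * p.2 i) - ν := by
        rw [hfeas p.2 hp2, hps, hp1]
        ring
      refine ⟨hp, fun q hq => ?_⟩
      rw [hval p hp, hval q hq, hopt p.2 hp2, hp1]
      have := Finset.sum_nonneg (hnn q.2)
      have := sq_nonneg (q.1 - σ₀)
      simp only [sub_self]
      linarith
  refine ⟨fun h => main h.le, fun h => ?_⟩
  rw [main h.ge, h]
  ext ⟨ξ, w⟩
  simp only [Set.mem_ofPred_eq, Set.mem_singleton_iff, Prod.mk.injEq,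
    Finset.sum_eq_zero_iff_of_nonneg fun i _ => sq_nonneg (w i - φ i), Finset.mem_filter,
    Finset.mem_univ, true_and, pow_eq_zero_iff two_ne_zero, sub_eq_zero]
  refine and_congr_right fun _ => ⟨fun hw => funext fun i => ?_, ?_⟩
  · split_ifs with hi
    · exact hw.2 i hi
    · exact hw.1 i hi
  · rintro rfl
    exact ⟨fun j hj => if_neg hj, fun i hi => if_pos hi⟩
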